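/- Full law identification in the no-self-censoring model. Let K ≥ 1 and let χ₁, …, χ_K be finite nonempty types. Consider strictly positive probability mass functions on Bool^K × (χ₁ × ⋯ × χ_K), viewed as joint laws of missingness indicators R = (R₁, …, R_K) and potentially missing variables Z = (Z₁, …, Z_K). The observed data law induced by such a pmf is the law of the pair (R, Z*) where the observed proxy Z*_k equals 'some Z_k' if R_k = 1 and 'none' (missing) if R_k = 0. Suppose p and q are strictly positive pmfs each satisfying the no-self-censoring conditions: for every k, R_k ⊥ Z_k | (R_{−k}, Z_{−k}) (where the subscript −k denotes all coordinates other than k). If p and q induce the same observed data law, then p = q; i.e., the full law in the no-self-censoring model is identified from the observed data law. -/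

import Mathlib

open scoped BigOperators

/-- Probability of the event `A` under the (finitely supported) law `p`. -/
noncomputable def Pr {Ω : Type*} [Fintype Ω] (p : Ω → ℝ) (A : Set Ω) : ℝ :=
  ∑ ω, A.indicator p ω

/-- Conditional probability `p(A | B) = p(A ∩ B) / p(B)`. -/
noncomputable def cPr {Ω : Type*} [Fintype Ω] (p : Ω → ℝ) (A B : Set Ω) : ℝ :=
  Pr p (A ∩ B) / Pr p B

theorem Pr_pos {Ω : Type*} [Fintype Ω] {p : Ω → ℝ} (hp : ∀ x, 0 < p x) {A : Set Ω} {x : Ω}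
    (hx : x ∈ A) : 0 < Pr p A := by
  refine Finset.sum_pos' (fun y _ => Set.indicator_nonneg (fun y _ => (hp y).le) y)
    ⟨x, Finset.mem_univ x, ?_⟩
  rw [Set.indicator_of_mem hx]
  exact hp x

theorem Pr_singleton {Ω : Type*} [Fintype Ω] (p : Ω → ℝ) (x : Ω) : Pr p {x} = p x := by
  classical
  simp [Pr, Set.indicator_apply]

section NoSelfCensoring

variable {ι : Type*} [Fintype ι] [DecidableEq ι] {χ : ι → Type*} [∀ k, Fintype (χ k)]

/-- `R_k ⊥ Z_k | (R_{−k}, Z_{−k})` under the law `p`. -/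
def NoSelfCensoringAt (p : ((ι → Bool) × (∀ k, χ k)) → ℝ) (k : ι) : Prop :=
  ∀ (b : Bool) (c : χ k) (r : ι → Bool) (z : ∀ j, χ j),
    cPr p {x | x.1 k = b ∧ x.2 k = c} {x | ∀ j, j ≠ k → x.1 j = r j ∧ x.2 j = z j}
      = cPr p {x | x.1 k = b} {x | ∀ j, j ≠ k → x.1 j = r j ∧ x.2 j = z j}
        * cPr p {x | x.2 k = c} {x | ∀ j, j ≠ k → x.1 j = r j ∧ x.2 j = z j}

/-- Without self-censoring the conditional odds ratio of `R_k` and `Z_k` is one. -/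
theorem NoSelfCensoringAt.odds_ratio {p : ((ι → Bool) × (∀ k, χ k)) → ℝ} (hp : ∀ x, 0 < p x)
    {k : ι} (h : NoSelfCensoringAt p k) (r : ι → Bool) (z : ∀ j, χ j) (b : Bool) (c : χ k) :
    p (r, z) * p (Function.update r k b, Function.update z k c)
      = p (r, Function.update z k c) * p (Function.update r k b, z) := by
  set B : Set ((ι → Bool) × (∀ k, χ k)) := {x | ∀ j, j ≠ k → x.1 j = r j ∧ x.2 j = z j} with hB
  have hpos : 0 < Pr p B := Pr_pos hp (x := (r, z)) fun j _ => ⟨rfl, rfl⟩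
  have joint (b : Bool) (c : χ k) :
      p (Function.update r k b, Function.update z k c) / Pr p B
        = cPr p {x | x.1 k = b} B * cPr p {x | x.2 k = c} B := by
    rw [← h b c r z, cPr, ← hB, ← Pr_singleton p]
    congr 2
    ext ⟨r', z'⟩
    simp only [Set.mem_singleton_iff, Prod.mk.injEq, Function.eq_update_iff, hB,
      Set.mem_inter_iff, Set.mem_ofPred_eq]
    constructor
    · rintro ⟨⟨h₁, h₂⟩, h₃, h₄⟩
      exact ⟨⟨h₁, h₃⟩, fun j hj => ⟨h₂ j hj, h₄ j hj⟩⟩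
    · rintro ⟨⟨h₁, h₃⟩, h₂⟩
      exact ⟨⟨h₁, fun j hj => (h₂ j hj).1⟩, h₃, fun j hj => (h₂ j hj).2⟩
  have h₁ := joint (r k) (z k)
  have h₂ := joint (r k) c
  have h₃ := joint b (z k)
  have h₄ := joint b c
  simp only [Function.update_eq_self] at h₁ h₂ h₃
  rw [div_eq_iff hpos.ne'] at h₁ h₂ h₃ h₄
  rw [h₁, h₂, h₃, h₄]
  ring

/-- If two laws without self-censoring agree once `R_k` is set to observed, then their likelihood
ratio does not depend on `Z_k`. -/
theorem div_update_eq {p q : ((ι → Bool) × (∀ k, χ k)) → ℝ} (hp : ∀ x, 0 < p x)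
    (hq : ∀ x, 0 < q x) {k : ι} (hpk : NoSelfCensoringAt p k) (hqk : NoSelfCensoringAt q k)
    {r : ι → Bool} (h : ∀ z, p (Function.update r k true, z) = q (Function.update r k true, z))
    (z : ∀ j, χ j) (c : χ k) :
    p (r, Function.update z k c) / q (r, Function.update z k c) = p (r, z) / q (r, z) := by
  have hp' := hpk.odds_ratio hp r z true c
  have hq' := hqk.odds_ratio hq r z true c
  rw [h, h] at hp'
  rw [div_eq_div_iff (hq _).ne' (hq _).ne']
  refine mul_right_cancel₀ (mul_pos (hq (Function.update r k true, z))
    (hq (Function.update r k true, Function.update z k c))).ne' ?_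
  linear_combination (-q (r, z) * q (Function.update r k true, Function.update z k c)) * hp'
    + p (r, z) * q (Function.update r k true, Function.update z k c) * hq'

/-- If two laws without self-censoring agree on every pattern with one more observed coordinate
than `r`, then their likelihood ratio at `r` depends only on the observed coordinates. -/
theorem div_eq_div_of_agree {p q : ((ι → Bool) × (∀ k, χ k)) → ℝ} (hp : ∀ x, 0 < p x)
    (hq : ∀ x, 0 < q x) (hpk : ∀ k, NoSelfCensoringAt p k) (hqk : ∀ k, NoSelfCensoringAt q k)
    {r : ι → Bool} (h : ∀ k, r k = false →
      ∀ z, p (Function.update r k true, z) = q (Function.update r k true, z))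
    {z z' : ∀ j, χ j} (hz : ∀ k, r k = true → z' k = z k) :
    p (r, z') / q (r, z') = p (r, z) / q (r, z) := by
  have key (s : Finset ι) (hs : ∀ k ∈ s, r k = false) :
      p (r, s.piecewise z' z) / q (r, s.piecewise z' z) = p (r, z) / q (r, z) := by
    induction s using Finset.induction_on with
    | empty => simp
    | insert k s _ ih =>
      rw [Finset.piecewise_insert, div_update_eq hp hq (hpk k) (hqk k)
        (h k (hs k (Finset.mem_insert_self k s)))]
      exact ih fun j hj => hs j (Finset.mem_insert_of_mem hj)
  have hz' : (Finset.univ.filter fun k => r k = false).piecewise z' z = z' := by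
    ext k
    by_cases hk : r k = false
    · simp [Finset.piecewise, hk]
    · simp [Finset.piecewise, hk, hz k (by simpa using hk)]
  simpa only [hz'] using key (Finset.univ.filter fun k => r k = false) (by simp)

/-- Two positive laws without self-censoring and with the same observed data law are equal. -/
theorem eq_of_observed_eq {p q : ((ι → Bool) × (∀ k, χ k)) → ℝ} (hp : ∀ x, 0 < p x)
    (hq : ∀ x, 0 < q x) (hpk : ∀ k, NoSelfCensoringAt p k) (hqk : ∀ k, NoSelfCensoringAt q k)
    (hobs : ∀ (r : ι → Bool) (zstar : ∀ k, Option (χ k)),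
      Pr p {x | x.1 = r ∧ ∀ k, (if x.1 k then some (x.2 k) else none) = zstar k}
        = Pr q {x | x.1 = r ∧ ∀ k, (if x.1 k then some (x.2 k) else none) = zstar k})
    (r : ι → Bool) (z : ∀ k, χ k) : p (r, z) = q (r, z) := by
  induction hn : (Finset.univ.filter fun k => r k = false).card using Nat.strong_induction_on
    generalizing r z with
  | _ n ih =>
    have h (k : ι) (hk : r k = false) (z : ∀ j, χ j) :
        p (Function.update r k true, z) = q (Function.update r k true, z) := by
      refine ih _ ?_ _ z rfl
      rw [← hn]
      refine Finset.card_lt_card (Finset.ssubset_iff_of_subset ?_ |>.2 ⟨k, by simp [hk], by simp⟩)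
      intro j
      by_cases hj : j = k
      · simp [hj]
      · simp [hj]
    have hA := hobs r fun k => if r k then some (z k) else none
    set A : Set ((ι → Bool) × (∀ k, χ k)) := {x | x.1 = r ∧
      ∀ k, (if x.1 k then some (x.2 k) else none) = if r k then some (z k) else none} with hAdef
    have hpos : 0 < Pr q A := Pr_pos hq (x := (r, z)) ⟨rfl, fun _ => rfl⟩
    have hratio : Pr p A = p (r, z) / q (r, z) * Pr q A := by
      rw [Pr, Pr, Finset.mul_sum]
      refine Finset.sum_congr rfl fun x _ => ?_
      by_cases hx : x ∈ A
      · rw [Set.indicator_of_mem hx, Set.indicator_of_mem hx]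
        obtain ⟨r', z'⟩ := x
        obtain ⟨rfl, hz⟩ := hx
        rw [← div_eq_div_of_agree hp hq hpk hqk h (z' := z')
          fun k hk => Option.some_injective _ (by simpa only [if_pos hk] using hz k),
          div_mul_cancel₀ _ (hq _).ne']
      · simp [Set.indicator_of_notMem hx]
    rw [hA] at hratio
    exact (div_eq_one_iff_eq (hq _).ne').1 ((mul_eq_right₀ hpos.ne').1 hratio.symm)

end NoSelfCensoring

/-- Full law identification in the no-self-censoring model: two strictly positive
full laws of `(R, Z)` on `(Fin K → Bool) × (∀ k, χ k)`, each satisfying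
`R_k ⊥ Z_k | (R_{−k}, Z_{−k})` for every `k`, that induce the same observed data law of
`(R, Z*)` (where `Z*_k = some (Z_k)` if `R_k = 1` and `none` otherwise) are equal. -/
theorem stmt_8 {K : ℕ} (hK : 1 ≤ K) (χ : Fin K → Type*)
    [∀ k, Fintype (χ k)] [∀ k, Nonempty (χ k)]
    (p q : ((Fin K → Bool) × (∀ k, χ k)) → ℝ)
    (hp : ∀ x, 0 < p x) (hq : ∀ x, 0 < q x)
    (hpsum : ∑ x, p x = 1) (hqsum : ∑ x, q x = 1)
    (hpNSC : ∀ (k : Fin K) (b : Bool) (c : χ k) (r : Fin K → Bool) (z : ∀ j, χ j),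
      cPr p {x | x.1 k = b ∧ x.2 k = c} {x | ∀ j, j ≠ k → x.1 j = r j ∧ x.2 j = z j}
        = cPr p {x | x.1 k = b} {x | ∀ j, j ≠ k → x.1 j = r j ∧ x.2 j = z j}
          * cPr p {x | x.2 k = c} {x | ∀ j, j ≠ k → x.1 j = r j ∧ x.2 j = z j})
    (hqNSC : ∀ (k : Fin K) (b : Bool) (c : χ k) (r : Fin K → Bool) (z : ∀ j, χ j),
      cPr q {x | x.1 k = b ∧ x.2 k = c} {x | ∀ j, j ≠ k → x.1 j = r j ∧ x.2 j = z j}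
        = cPr q {x | x.1 k = b} {x | ∀ j, j ≠ k → x.1 j = r j ∧ x.2 j = z j}
          * cPr q {x | x.2 k = c} {x | ∀ j, j ≠ k → x.1 j = r j ∧ x.2 j = z j})
    (hobs : ∀ (r : Fin K → Bool) (zstar : ∀ k, Option (χ k)),
      Pr p {x | x.1 = r ∧ ∀ k, (if x.1 k then some (x.2 k) else none) = zstar k}
        = Pr q {x | x.1 = r ∧ ∀ k, (if x.1 k then some (x.2 k) else none) = zstar k}) :
    p = q := by
  exact funext fun x => eq_of_observed_eq hp hq hpNSC hqNSC hobs x.1 x.2
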